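/- For all s ∈ ℕ and p ∈ {0,1}, the subsemigroup B(s,p) = { (s,s,p)·x·(s,s,p) : x ∈ B } is isomorphic as a semigroup to B itself, i.e., there exists a multiplicative bijection from B onto B(s,p). -/

import Mathlib

/-- The underlying set of the semigroup `B_ω^{F²}`: `ℕ × ℕ × {0,1}`. -/
abbrev B : Type := ℕ × ℕ × Fin 2

/-- Truncated subtraction of a natural number from an element of `{0,1}`. -/
def fsub (p : Fin 2) (n : ℕ) : Fin 2 :=
  ⟨p.val - n, lt_of_le_of_lt (Nat.sub_le _ _) p.isLt⟩

/-- The multiplication on `B = ℕ × ℕ × {0,1}` realizing the semigroup `B_ω^{F²}`.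
In the first case `i₁ − j₁ + i₂` is computed as `i₁ + (i₂ − j₁)` (exact, since
`j₁ < i₂`), and in the third case `j₁ − i₂ + j₂` as `(j₁ − i₂) + j₂` (exact, since
`j₁ > i₂`). -/
def bmul (x y : B) : B :=
  if x.2.1 < y.1 then
    (x.1 + (y.1 - x.2.1), y.2.1, max (fsub x.2.2 (y.1 - x.2.1)) y.2.2)
  else if x.2.1 = y.1 then
    (x.1, y.2.1, max x.2.2 y.2.2)
  else
    (x.1, x.2.1 - y.1 + y.2.1, max x.2.2 (fsub y.2.2 (x.2.1 - y.1)))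

/-- The subsemigroup `B(s,p) = (s,s,p)·B·(s,s,p)`. -/
def Bsp (s : ℕ) (p : Fin 2) : Set B :=
  {y : B | ∃ x : B, y = bmul (bmul (s, s, p) x) (s, s, p)}

/-- Truncated subtraction of a positive number sends `{0,1}` to `0`. -/
lemma fsub_of_pos (p : Fin 2) {n : ℕ} (hn : 0 < n) : fsub p n = 0 := by
  ext
  simp only [fsub, Fin.val_zero]
  omega

lemma bmul_of_lt {i j k l : ℕ} (q r : Fin 2) (h : j < k) :
    bmul (i, j, q) (k, l, r) = (i + (k - j), l, r) := by
  simp [bmul, h, fsub_of_pos q (Nat.sub_pos_of_lt h)]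

lemma bmul_of_eq (i j l : ℕ) (q r : Fin 2) :
    bmul (i, j, q) (j, l, r) = (i, l, max q r) := by
  simp [bmul]

lemma bmul_of_gt {i j k l : ℕ} (q r : Fin 2) (h : k < j) :
    bmul (i, j, q) (k, l, r) = (i, j - k + l, q) := by
  simp [bmul, h.not_gt, h.ne', fsub_of_pos r (Nat.sub_pos_of_lt h)]

/-- The two-sided shift `(i, j, q) ↦ (i + s, j + s, q)`. -/
def shift (s : ℕ) (x : B) : B := (x.1 + s, x.2.1 + s, x.2.2)

/-- The half shift `(i, j, 0) ↦ (i, j, 1)`, `(i, j, 1) ↦ (i + 1, j + 1, 0)`. -/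
def halfShift (x : B) : B :=
  (x.1 + x.2.2.val, x.2.1 + x.2.2.val, 1 - x.2.2)

lemma shift_injective (s : ℕ) : Function.Injective (shift s) := by
  rintro ⟨i, j, q⟩ ⟨k, l, r⟩ h
  simpa [shift] using h

lemma halfShift_injective : Function.Injective halfShift := by
  rintro ⟨i, j, q⟩ ⟨k, l, r⟩ h
  fin_cases q <;> fin_cases r <;> simp_all [halfShift]

lemma shift_bmul (s : ℕ) (x y : B) : shift s (bmul x y) = bmul (shift s x) (shift s y) := by
  obtain ⟨i, j, q⟩ := x
  obtain ⟨k, l, r⟩ := y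
  simp only [shift]
  rcases lt_trichotomy j k with h | rfl | h
  · rw [bmul_of_lt q r h, bmul_of_lt q r (by omega)]
    grind
  · simp only [bmul_of_eq]
  · rw [bmul_of_gt q r h, bmul_of_gt q r (by omega)]
    grind

lemma halfShift_bmul (x y : B) : halfShift (bmul x y) = bmul (halfShift x) (halfShift y) := by
  obtain ⟨i, j, q⟩ := x
  obtain ⟨k, l, r⟩ := y
  fin_cases q <;> fin_cases r <;>
    simp only [halfShift, bmul, fsub, Prod.ext_iff, Fin.ext_iff] <;> split_ifs <;>
    simp [Fin.val_sub, Fin.coe_max] <;> grind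

/-- The elements of `B(s,p)` are those with both coordinates at least `s`, the last one being at
least `p` when one of the coordinates equals `s`. -/
lemma mem_Bsp_iff (s : ℕ) (p : Fin 2) (i j : ℕ) (q : Fin 2) :
    (i, j, q) ∈ Bsp s p ↔ s ≤ i ∧ s ≤ j ∧ (i = s ∨ j = s → p ≤ q) := by
  constructor
  · rintro ⟨⟨k, l, r⟩, h⟩
    rcases lt_trichotomy s k with hk | rfl | hk
    · rw [bmul_of_lt _ _ hk] at h
      rcases lt_trichotomy l s with hl | rfl | hl
      · rw [bmul_of_lt _ _ hl] at h
        grind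
      · rw [bmul_of_eq] at h
        grind
      · rw [bmul_of_gt _ _ hl] at h
        grind
    · rw [bmul_of_eq] at h
      rcases lt_trichotomy l s with hl | rfl | hl
      · rw [bmul_of_lt _ _ hl] at h
        grind
      · rw [bmul_of_eq] at h
        grind
      · rw [bmul_of_gt _ _ hl] at h
        grind
    · rw [bmul_of_gt _ _ hk] at h
      rcases lt_trichotomy (s - k + l) s with hl | hl | hl
      · rw [bmul_of_lt _ _ hl] at h
        grind
      · rw [hl, bmul_of_eq] at h
        grind
      · rw [bmul_of_gt _ _ hl] at h
        grind
  · rintro ⟨hi, hj, hq⟩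
    refine ⟨(i, j, q), ?_⟩
    have left : bmul (s, s, p) (i, j, q) = (i, j, q) := by
      rcases hi.lt_or_eq with h | rfl
      · rw [bmul_of_lt _ _ h, Nat.add_sub_cancel' hi]
      · rw [bmul_of_eq, max_eq_right (hq (.inl rfl))]
    rw [left]
    rcases hj.lt_or_eq with h | rfl
    · rw [bmul_of_gt _ _ h, Nat.sub_add_cancel hj]
    · rw [bmul_of_eq, max_eq_left (hq (.inr rfl))]

lemma range_shift (s : ℕ) : Set.range (shift s) = Bsp s 0 := by
  ext ⟨i, j, q⟩
  rw [mem_Bsp_iff]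
  constructor
  · rintro ⟨⟨k, l, r⟩, h⟩
    simp only [shift, Prod.mk.injEq] at h
    exact ⟨by omega, by omega, fun _ => Fin.zero_le q⟩
  · rintro ⟨hi, hj, -⟩
    exact ⟨(i - s, j - s, q), by simp [shift, hi, hj]⟩

lemma range_shift_comp_halfShift (s : ℕ) : Set.range (shift s ∘ halfShift) = Bsp s 1 := by
  ext ⟨i, j, q⟩
  rw [mem_Bsp_iff]
  constructor
  · rintro ⟨⟨k, l, r⟩, h⟩
    fin_cases r <;> simp [shift, halfShift] at h <;>
      obtain ⟨rfl, rfl, rfl⟩ := h <;> simp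
  · rintro ⟨hi, hj, hq⟩
    fin_cases q
    · have hi' : i ≠ s := fun h => absurd (hq (.inl h)) (by decide)
      have hj' : j ≠ s := fun h => absurd (hq (.inr h)) (by decide)
      refine ⟨(i - s - 1, j - s - 1, 1), ?_⟩
      simp [shift, halfShift]
      omega
    · exact ⟨(i - s, j - s, 0), by simp [shift, halfShift, hi, hj]⟩

/-- For all `s ∈ ℕ` and `p ∈ {0,1}`, the subsemigroup `B(s,p)` is isomorphic to `B`:
there is a multiplicative bijection from `B` onto `B(s,p)`. -/
theorem Bsp_isomorphic_to_B (s : ℕ) (p : Fin 2) :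
    ∃ f : B → B, Function.Injective f ∧ Set.range f = Bsp s p ∧
      ∀ x y : B, f (bmul x y) = bmul (f x) (f y) := by
  fin_cases p
  · exact ⟨shift s, shift_injective s, range_shift s, shift_bmul s⟩
  · refine ⟨shift s ∘ halfShift, (shift_injective s).comp halfShift_injective,
      range_shift_comp_halfShift s, fun x y => ?_⟩
    simp only [Function.comp_apply, halfShift_bmul, shift_bmul]
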